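/- arXiv:math/0312320 — 7 statements merged into one kernel-verified Lean document; each statement's English description precedes it below -/
import Mathlib

section
/- Let q ∈ ℕ with q ≥ 7 and gcd(3, q) = 1. Then δ(K⁰_{3,q}) ≤ A(3/q), where K⁰_{3,q} = {3, 4, …, q−3}. -/
open Real

/-- Evaluation of the trigonometric polynomial with (finitely supported) cosine
coefficients `c` at the point `x`:  `T(x) = Σ_k c k · cos(2πkx)`.
The constant term is the `k = 0` coefficient. -/
noncomputable def trigEval (c : ℕ →₀ ℝ) (x : ℝ) : ℝ :=
  c.sum fun k a => a * Real.cos (2 * π * k * x)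

/-- The class `𝐓(K)`: trigonometric polynomials `T(x) = T₀ + Σ_{k ∈ K} T_k cos(2πkx)`
(nonzero-frequency coefficients supported in `K`), with `T(x) ≥ 0` for all `x`
and `T(0) = 1`.  A polynomial is represented by its coefficient function. -/
def TrigClass (K : Set ℕ) : Set (ℕ →₀ ℝ) :=
  {c | (∀ k : ℕ, k ≠ 0 → c k ≠ 0 → k ∈ K) ∧
       (∀ x : ℝ, 0 ≤ trigEval c x) ∧
       trigEval c 0 = 1}

/-- `δ(K) = inf_{T ∈ 𝐓(K)} T₀`. -/
noncomputable def delta (K : Set ℕ) : ℝ :=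
  sInf ((fun c : ℕ →₀ ℝ => c 0) '' TrigClass K)

/-- The Turán class `K(h)`, described by the cosine coefficient sequence `a`:
`a_n ≥ 0`, `Σ a_n = 1` (i.e. `f(0) = 1`), and
`f(x) = Σ_n a_n cos(2πnx) = 0` for `h ≤ |x| ≤ 1/2`. -/
def TuranClass (h : ℝ) : Set (ℕ → ℝ) :=
  {a | (∀ n, 0 ≤ a n) ∧ Summable a ∧ (∑' n, a n) = 1 ∧
       ∀ x : ℝ, h ≤ |x| → |x| ≤ 1 / 2 →
         (∑' n : ℕ, a n * Real.cos (2 * π * n * x)) = 0}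

/-- `A(h) = sup_{f ∈ K(h)} a₀`. -/
noncomputable def turanA (h : ℝ) : ℝ :=
  sSup ((fun a : ℕ → ℝ => a 0) '' TuranClass h)

/-- `K⁰_{p,q} = {p, p+1, …, q−p}`. -/
def Kset0 (p q : ℕ) : Set ℕ := {k | p ≤ k ∧ k ≤ q - p}

/-- `K_{p,q} = {qν + k : ν ∈ ℤ₊, k ∈ K⁰_{p,q}}`. -/
def Kset (p q : ℕ) : Set ℕ :=
  {k | ∃ ν k' : ℕ, k = q * ν + k' ∧ p ≤ k' ∧ k' ≤ q - p}

noncomputable def eK (k : ℕ) : ℝ := if k = 0 then 1 else 2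

/-- Unnormalised Fejer kernel. -/
noncomputable def GK (q : ℕ) (t : ℝ) : ℝ :=
  ∑ k ∈ Finset.range q, eK k * ((q : ℝ) - k) * Real.cos (k * t)

noncomputable def DK (q : ℕ) (t : ℝ) : ℝ :=
  ∑ k ∈ Finset.range (q + 1), eK k * Real.cos (k * t)

lemma GK_succ (q : ℕ) (t : ℝ) : GK (q + 1) t = GK q t + DK q t := by
  unfold GK DK
  rw [Finset.sum_range_succ, Finset.sum_range_succ, ← add_assoc, ← Finset.sum_add_distrib]
  congr 1
  · apply Finset.sum_congr rfl
    intro k _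
    push_cast; ring
  · push_cast; ring

lemma DK_mul (q : ℕ) (t : ℝ) :
    (1 - Real.cos t) * DK q t = Real.cos (q * t) - Real.cos ((q + 1 : ℕ) * t) := by
  induction q with
  | zero => simp [DK, eK]
  | succ n ih =>
    have h : DK (n + 1) t = DK n t + 2 * Real.cos ((n + 1 : ℕ) * t) := by
      unfold DK
      rw [Finset.sum_range_succ _ (n + 1)]
      simp [eK]
    rw [h, mul_add, ih]
    have h1 : ((n : ℕ) : ℝ) * t = ((n + 1 : ℕ) : ℝ) * t - t := by push_cast; ring
    have h2 : ((n + 1 + 1 : ℕ) : ℝ) * t = ((n + 1 : ℕ) : ℝ) * t + t := by push_cast; ring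
    rw [h1, h2, Real.cos_sub, Real.cos_add]
    ring

lemma GK_mul (q : ℕ) (t : ℝ) :
    (1 - Real.cos t) * GK q t = 1 - Real.cos (q * t) := by
  induction q with
  | zero => simp [GK]
  | succ n ih =>
    rw [GK_succ, mul_add, ih, DK_mul]; ring

lemma DK_one (n : ℕ) (t : ℝ) (h : ∀ k : ℕ, Real.cos (k * t) = 1) : DK n t = 2 * n + 1 := by
  induction n with
  | zero => simp [DK, eK]
  | succ n ih =>
    have h' : DK (n + 1) t = DK n t + 2 * Real.cos ((n + 1 : ℕ) * t) := by
      unfold DK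
      rw [Finset.sum_range_succ _ (n + 1)]
      simp [eK]
    rw [h', ih, h]; push_cast; ring

lemma GK_one (n : ℕ) (t : ℝ) (h : ∀ k : ℕ, Real.cos (k * t) = 1) : GK n t = n ^ 2 := by
  induction n with
  | zero => simp [GK]
  | succ n ih =>
    rw [GK_succ, ih, DK_one n t h]; push_cast; ring

lemma GK_nonneg (q : ℕ) (t : ℝ) : 0 ≤ GK q t := by
  by_cases h : Real.cos t = 1
  · have h1 : ∀ k : ℕ, Real.cos (k * t) = 1 := by
      intro k
      obtain ⟨n, hn⟩ := (Real.cos_eq_one_iff t).1 h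
      rw [Real.cos_eq_one_iff]
      exact ⟨k * n, by rw [← hn]; push_cast; ring⟩
    rw [GK_one q t h1]; positivity
  · have h2 : 0 < 1 - Real.cos t := by
      have := lt_of_le_of_ne (Real.cos_le_one t) h
      linarith
    have h3 := GK_mul q t
    have h4 := Real.cos_le_one (q * t)
    by_contra hc
    push Not at hc
    nlinarith

lemma GK_zero_of (q : ℕ) (t : ℝ) (h : Real.cos t ≠ 1) (h' : Real.cos (q * t) = 1) :
    GK q t = 0 := by
  have h3 := GK_mul q t
  rw [h', sub_self] at h3
  rcases mul_eq_zero.1 h3 with h4 | h4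
  · exact absurd (by linarith) h
  · exact h4

/-- hat function coefficients -/
noncomputable def hK (q : ℕ) (n : ℕ) : ℝ :=
  if n = 0 then 1 / (q : ℝ) else q / π ^ 2 * (1 / (n : ℝ) ^ 2) * (1 - Real.cos (2 * π * n / q))

lemma hK_nonneg (q n : ℕ) : 0 ≤ hK q n := by
  unfold hK
  split_ifs
  · positivity
  · have := Real.cos_le_one (2 * π * n / q)
    apply mul_nonneg
    · positivity
    · linarith

lemma hasSum_B2 {x : ℝ} (h0 : 0 ≤ x) (h1 : x ≤ 1) :
    HasSum (fun n : ℕ => 1 / (n : ℝ) ^ 2 * Real.cos (2 * π * n * x)) (π ^ 2 * (x ^ 2 - x + 1 / 6)) := by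
  have h := hasSum_one_div_nat_pow_mul_cos (k := 1) one_ne_zero (x := x) ⟨h0, h1⟩
  have e : (Polynomial.map (algebraMap ℚ ℝ) (Polynomial.bernoulli 2)).eval x = x ^ 2 - x + 1 / 6 := by
    simp [Polynomial.bernoulli, Finset.sum_range_succ, bernoulli_eq_bernoulli'_of_ne_one]
    try ring
  simp only [Nat.mul_one] at h
  rw [e] at h
  convert h using 1
  have : ((Nat.factorial 2 : ℕ) : ℝ) = 2 := by norm_num [Nat.factorial]
  rw [this]
  ring

lemma hasSum_hK_aux (q : ℕ) (hq : 0 < q) (y v : ℝ) (g g1 g2 : ℝ)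
    (h : HasSum (fun n : ℕ => 1 / (n : ℝ) ^ 2 * Real.cos (2 * π * n * y)) (π ^ 2 * g))
    (h1 : HasSum (fun n : ℕ => 1 / (n : ℝ) ^ 2 * Real.cos (2 * π * n * (y + 1 / q))) (π ^ 2 * g1))
    (h2 : HasSum (fun n : ℕ => 1 / (n : ℝ) ^ 2 * Real.cos (2 * π * n * (y - 1 / q))) (π ^ 2 * g2))
    (hv : v = 1 / q + q * (g - (g1 + g2) / 2)) :
    HasSum (fun n : ℕ => hK q n * Real.cos (2 * π * n * y)) v := by
  have h3 := (h.sub ((h1.add h2).div_const 2)).mul_left ((q : ℝ) / π ^ 2)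
  have h4 : HasSum (fun n : ℕ => if n = 0 then 1 / (q : ℝ) else 0) (1 / (q : ℝ)) := by
    convert hasSum_ite_eq (0 : ℕ) (1 / (q : ℝ)) using 1
  have h5 := h4.add h3
  convert h5 using 1
  · funext n
    unfold hK
    by_cases hn : n = 0
    · simp [hn]
    · simp only [hn, if_false]
      have e1 : 2 * π * n * (y + 1 / q) = 2 * π * n * y + 2 * π * n / q := by ring
      have e2 : 2 * π * n * (y - 1 / q) = 2 * π * n * y - 2 * π * n / q := by ring
      rw [e1, e2, Real.cos_add, Real.cos_sub]
      ring
  · rw [hv]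
    have := Real.pi_ne_zero
    field_simp

lemma hasSum_hK_zero (q : ℕ) (hq : 0 < q) (y : ℝ) (h0 : 1 / (q : ℝ) ≤ y) (h1 : y ≤ 1 - 1 / q) :
    HasSum (fun n : ℕ => hK q n * Real.cos (2 * π * n * y)) 0 := by
  have hq' : (0 : ℝ) < q := by exact_mod_cast hq
  have hi : 0 < 1 / (q : ℝ) := by positivity
  refine hasSum_hK_aux q hq y 0 _ _ _ (hasSum_B2 (by linarith) (by linarith))
    (hasSum_B2 (by linarith) (by linarith)) (hasSum_B2 (by linarith) (by linarith)) ?_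
  field_simp
  ring

lemma hasSum_hK_one (q : ℕ) (hq : 0 < q) :
    HasSum (fun n : ℕ => hK q n * Real.cos (2 * π * n * 0)) 1 := by
  have hq' : (1 : ℝ) ≤ q := by exact_mod_cast hq
  have hi : 0 < 1 / (q : ℝ) := by positivity
  have hi' : 1 / (q : ℝ) ≤ 1 := by rw [div_le_one (by linarith)]; exact hq'
  have a := hasSum_B2 (x := 1 / (q : ℝ)) hi.le hi'
  refine hasSum_hK_aux q hq 0 1 _ _ ((1 / (q : ℝ)) ^ 2 - 1 / q + 1 / 6)
    (hasSum_B2 (x := 0) (by linarith) (by linarith)) (by rw [zero_add]; exact a) ?_ ?_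
  · convert a using 3 with n
    rw [← Real.cos_neg]; congr 1; ring
  · field_simp
    ring

lemma cos_grid (q m : ℕ) (hq : 0 < q) (hm : 2 * (m + 1) ≤ q) (n : ℕ) :
    Real.cos (2 * π * m / q) ≤ Real.cos (2 * π * n / q) ∨
    Real.cos (2 * π * n / q) ≤ Real.cos (2 * π * (m + 1 : ℕ) / q) := by
  have hq' : (0 : ℝ) < q := by exact_mod_cast hq
  have mono : ∀ a b : ℕ, a ≤ b → 2 * b ≤ q →
      Real.cos (2 * π * b / q) ≤ Real.cos (2 * π * a / q) := by
    intro a b hab hb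
    have hb' : 2 * (b : ℝ) ≤ q := by exact_mod_cast hb
    have hab' : (a : ℝ) ≤ b := by exact_mod_cast hab
    apply Real.cos_le_cos_of_nonneg_of_le_pi
    · positivity
    · rw [div_le_iff₀ hq']; nlinarith [Real.pi_pos]
    · gcongr
  have red : Real.cos (2 * π * n / q) = Real.cos (2 * π * (n % q : ℕ) / q) := by
    have h : (n : ℝ) = (n % q : ℕ) + q * (n / q : ℕ) := by exact_mod_cast (Nat.mod_add_div n q).symm
    have : 2 * π * n / q = 2 * π * (n % q : ℕ) / q + (n / q : ℕ) * (2 * π) := by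
      rw [h]; field_simp
    rw [this, Real.cos_add_nat_mul_two_pi]
  rw [red]
  have hr : n % q < q := Nat.mod_lt _ hq
  generalize n % q = r at hr
  have hrefl : Real.cos (2 * π * r / q) = Real.cos (2 * π * (q - r : ℕ) / q) := by
    rw [Nat.cast_sub hr.le, ← Real.cos_two_pi_sub]
    congr 1; field_simp
  by_cases h1 : r ≤ m
  · left; exact mono _ _ h1 (by omega)
  · by_cases h2 : 2 * r ≤ q
    · right; exact mono _ _ (by omega) h2
    · rw [hrefl]
      by_cases h3 : q - r ≤ m
      · left; exact mono _ _ h3 (by omega)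
      · right; exact mono _ _ (by omega) (by omega)

noncomputable def cK (q : ℕ) (α β w1 w2 : ℝ) : ℕ →₀ ℝ :=
  Finsupp.onFinset (Finset.range q)
    (fun k => if k < q then eK k * ((q : ℝ) - k) / (q : ℝ) ^ 2 *
      (1 + 2 * w1 * Real.cos (k * α) + 2 * w2 * Real.cos (k * β)) else 0)
    (by
      intro k hk
      rw [Finset.mem_range]
      by_contra h
      simp [h] at hk)

lemma trigEval_cK (q : ℕ) (α β w1 w2 x : ℝ) :
    trigEval (cK q α β w1 w2) x =
      (GK q (2 * π * x) + w1 * (GK q (2 * π * x - α) + GK q (2 * π * x + α))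
        + w2 * (GK q (2 * π * x - β) + GK q (2 * π * x + β))) / (q : ℝ) ^ 2 := by
  unfold trigEval cK
  rw [Finsupp.onFinset_sum _ (by intro a; simp)]
  unfold GK
  rw [← Finset.sum_add_distrib, ← Finset.sum_add_distrib, Finset.mul_sum, Finset.mul_sum,
    ← Finset.sum_add_distrib, ← Finset.sum_add_distrib, Finset.sum_div]
  apply Finset.sum_congr rfl
  intro k hk
  rw [if_pos (Finset.mem_range.1 hk)]
  have e0 : 2 * π * k * x = k * (2 * π * x) := by ring
  rw [e0, mul_sub (k : ℝ) _ α, mul_add (k : ℝ) _ α, mul_sub (k : ℝ) _ β, mul_add (k : ℝ) _ β,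
    Real.cos_sub, Real.cos_add, Real.cos_sub, Real.cos_add]
  ring

lemma cK_mem (q : ℕ) (hq : 7 ≤ q) (α β w1 w2 : ℝ) (h1 : 0 ≤ w1) (h2 : 0 ≤ w2)
    (ha : Real.cos α ≠ 1) (hb : Real.cos β ≠ 1)
    (ka : ∃ a : ℕ, q * α = a * (2 * π)) (kb : ∃ b : ℕ, q * β = b * (2 * π))
    (e1 : 1 + 2 * w1 * Real.cos α + 2 * w2 * Real.cos β = 0)
    (e2 : 1 + 2 * w1 * (2 * Real.cos α ^ 2 - 1) + 2 * w2 * (2 * Real.cos β ^ 2 - 1) = 0) :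
    cK q α β w1 w2 ∈ TrigClass (Kset0 3 q) := by
  obtain ⟨a, ka⟩ := ka
  obtain ⟨b, kb⟩ := kb
  have hq' : (0 : ℝ) < q := by exact_mod_cast (by omega : 0 < q)
  refine ⟨?_, ?_, ?_⟩
  · intro k hk hc
    by_contra hK
    apply hc
    simp only [Kset0, Set.mem_ofPred_eq] at hK
    simp only [cK, Finsupp.onFinset_apply]
    split_ifs with hkq
    · apply mul_eq_zero_of_right
      have hrefl : ∀ (θ : ℝ) (j a : ℕ), j ≤ q → q * θ = a * (2 * π) →
          Real.cos ((q - j : ℕ) * θ) = Real.cos (j * θ) := by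
        intro θ j a hj h
        rw [Nat.cast_sub hj, sub_mul, h, Real.cos_nat_mul_two_pi_sub]
      have hcase : k = 1 ∨ k = 2 ∨ k = q - 1 ∨ k = q - 2 := by omega
      rcases hcase with rfl | rfl | rfl | rfl
      · simpa using e1
      · push_cast
        rw [Real.cos_two_mul, Real.cos_two_mul]; exact e2
      · rw [hrefl α 1 a (by omega) ka, hrefl β 1 b (by omega) kb]
        simpa using e1
      · rw [hrefl α 2 a (by omega) ka, hrefl β 2 b (by omega) kb]
        push_cast
        rw [Real.cos_two_mul, Real.cos_two_mul]; exact e2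
    · rfl
  · intro x
    rw [trigEval_cK]
    have := GK_nonneg q
    have n1 := this (2 * π * x)
    have n2 := this (2 * π * x - α)
    have n3 := this (2 * π * x + α)
    have n4 := this (2 * π * x - β)
    have n5 := this (2 * π * x + β)
    positivity
  · rw [trigEval_cK]
    have z : ∀ (θ : ℝ) (a : ℕ), Real.cos θ ≠ 1 → q * θ = a * (2 * π) →
        GK q (2 * π * 0 - θ) = 0 ∧ GK q (2 * π * 0 + θ) = 0 := by
      intro θ a h h'
      constructor
      · apply GK_zero_of
        · simpa using h
        · rw [mul_zero, zero_sub, mul_neg, Real.cos_neg, h', Real.cos_nat_mul_two_pi]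
      · apply GK_zero_of
        · simpa using h
        · rw [mul_zero, zero_add, h', Real.cos_nat_mul_two_pi]
    rw [(z α a ha ka).1, (z α a ha ka).2, (z β b hb kb).1, (z β b hb kb).2,
      GK_one q _ (by intro k; simp)]
    field_simp
    ring

lemma turan_mem (q : ℕ) (hq : 7 ≤ q) (f1 f2 : ℝ)
    (hP : ∀ n : ℕ, 0 ≤ 1 + 2 * f1 * Real.cos (2 * π * n / q)
      + 2 * f2 * (2 * Real.cos (2 * π * n / q) ^ 2 - 1)) :
    (fun n : ℕ => hK q n * (1 + 2 * f1 * Real.cos (2 * π * n / q)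
      + 2 * f2 * (2 * Real.cos (2 * π * n / q) ^ 2 - 1))) ∈ TuranClass (3 / q) := by
  have hq0 : 0 < q := by omega
  have hq7 : (7 : ℝ) ≤ q := by exact_mod_cast hq
  have hq' : (0 : ℝ) < q := by linarith
  have hi : 0 < 1 / (q : ℝ) := by positivity
  have hi7 : 1 / (q : ℝ) ≤ 1 / 7 := by gcongr
  have key : ∀ x v v1 v1' v2 v2' : ℝ,
      HasSum (fun n : ℕ => hK q n * Real.cos (2 * π * n * x)) v →
      HasSum (fun n : ℕ => hK q n * Real.cos (2 * π * n * (x + 1 / q))) v1 →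
      HasSum (fun n : ℕ => hK q n * Real.cos (2 * π * n * (x - 1 / q))) v1' →
      HasSum (fun n : ℕ => hK q n * Real.cos (2 * π * n * (x + 2 * (1 / q)))) v2 →
      HasSum (fun n : ℕ => hK q n * Real.cos (2 * π * n * (x - 2 * (1 / q)))) v2' →
      HasSum (fun n : ℕ => hK q n * (1 + 2 * f1 * Real.cos (2 * π * n / q)
        + 2 * f2 * (2 * Real.cos (2 * π * n / q) ^ 2 - 1)) * Real.cos (2 * π * n * x))
        (v + f1 * (v1 + v1') + f2 * (v2 + v2')) := by
    intro x v v1 v1' v2 v2' h h1 h1' h2 h2'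
    convert (h.add ((h1.add h1').mul_left f1)).add ((h2.add h2').mul_left f2) using 1
    funext n
    have e1 : 2 * π * n * (x + 1 / q) = 2 * π * n * x + 2 * π * n / q := by ring
    have e2 : 2 * π * n * (x - 1 / q) = 2 * π * n * x - 2 * π * n / q := by ring
    have e3 : 2 * π * n * (x + 2 * (1 / q)) = 2 * π * n * x + 2 * (2 * π * n / q) := by ring
    have e4 : 2 * π * n * (x - 2 * (1 / q)) = 2 * π * n * x - 2 * (2 * π * n / q) := by ring
    rw [e1, e2, e3, e4, Real.cos_add, Real.cos_sub, Real.cos_add, Real.cos_sub, Real.cos_two_mul]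
    ring
  have hneg : ∀ y v : ℝ, HasSum (fun n : ℕ => hK q n * Real.cos (2 * π * n * (-y))) v →
      HasSum (fun n : ℕ => hK q n * Real.cos (2 * π * n * y)) v := by
    intro y v h
    convert h using 3 with n
    rw [← Real.cos_neg]; congr 1; ring
  have h0 := key 0 1 0 0 0 0 (hasSum_hK_one q hq0)
    (hasSum_hK_zero q hq0 _ (by linarith) (by linarith))
    (hneg _ _ (hasSum_hK_zero q hq0 _ (by linarith) (by linarith)))
    (hasSum_hK_zero q hq0 _ (by linarith) (by linarith))
    (hneg _ _ (hasSum_hK_zero q hq0 _ (by linarith) (by linarith)))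
  simp only [mul_zero, Real.cos_zero, mul_one, add_zero] at h0
  refine ⟨fun n => mul_nonneg (hK_nonneg q n) (hP n), h0.summable, h0.tsum_eq, ?_⟩
  have h3 : (3 : ℝ) / q = 3 * (1 / q) := by ring
  have pos : ∀ x : ℝ, 3 / (q : ℝ) ≤ x → x ≤ 1 / 2 →
      (∑' n : ℕ, hK q n * (1 + 2 * f1 * Real.cos (2 * π * n / q)
        + 2 * f2 * (2 * Real.cos (2 * π * n / q) ^ 2 - 1)) * Real.cos (2 * π * n * x)) = 0 := by
    intro x hx hx'
    rw [h3] at hx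
    have := key x 0 0 0 0 0
      (hasSum_hK_zero q hq0 _ (by linarith) (by linarith))
      (hasSum_hK_zero q hq0 _ (by linarith) (by linarith))
      (hasSum_hK_zero q hq0 _ (by linarith) (by linarith))
      (hasSum_hK_zero q hq0 _ (by linarith) (by linarith))
      (hasSum_hK_zero q hq0 _ (by linarith) (by linarith))
    rw [this.tsum_eq]; ring
  intro x hx hx'
  have := pos |x| hx hx'
  rw [← this]
  congr 1
  funext n
  rcases abs_choice x with h | h
  · rw [h]
  · rw [h, ← Real.cos_neg (2 * π * n * -x)]
    congr 2; ring

lemma delta_le_of_mem (K : Set ℕ) (h : ℝ) (c : ℕ →₀ ℝ) (a : ℕ → ℝ) (hc : c ∈ TrigClass K)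
    (ha : a ∈ TuranClass h) (hca : c 0 = a 0) : delta K ≤ turanA h := by
  have hb : BddAbove ((fun a : ℕ → ℝ => a 0) '' TuranClass h) := by
    refine ⟨1, ?_⟩
    rintro _ ⟨b, ⟨b0, bs, b1, _⟩, rfl⟩
    show b 0 ≤ 1
    rw [← b1]
    exact bs.le_tsum 0 (fun j _ => b0 j)
  have h1 : a 0 ≤ turanA h := le_csSup hb ⟨a, ha, rfl⟩
  by_cases hB : BddBelow ((fun c : ℕ →₀ ℝ => c 0) '' TrigClass K)
  · have h2 : delta K ≤ c 0 := csInf_le hB ⟨c, hc, rfl⟩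
    linarith
  · have h2 : delta K = 0 := Real.sInf_of_not_bddBelow hB
    have := ha.1 0
    linarith

/-- The upper estimate for `p = 3`:  `δ(K⁰_{3,q}) ≤ A(3/q)`
for `q ≥ 7` with `gcd(3, q) = 1`. -/
theorem stmt_9 (q : ℕ) (hq : 7 ≤ q) (hgcd : Nat.gcd 3 q = 1) :
    delta (Kset0 3 q) ≤ turanA (3 / q) := by
  have hdiv : q % 3 ≠ 0 := by
    intro h
    have : 3 ∣ q := Nat.dvd_of_mod_eq_zero h
    have := Nat.gcd_eq_left this
    omega
  obtain ⟨m, hm⟩ : ∃ m, m = q / 3 := ⟨_, rfl⟩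
  have hm1 : 3 * m < q := by omega
  have hm2 : q < 3 * (m + 1) := by omega
  have hm3 : q ≤ 4 * m := by omega
  have hm4 : 2 * (m + 1) ≤ q := by omega
  have hq0 : 0 < q := by omega
  have hq' : (0 : ℝ) < q := by exact_mod_cast hq0
  have r1 : 3 * (m : ℝ) < q := by exact_mod_cast hm1
  have r2 : (q : ℝ) < 3 * ((m : ℝ) + 1) := by exact_mod_cast hm2
  have r3 : (q : ℝ) ≤ 4 * m := by exact_mod_cast hm3
  have r4 : 2 * ((m : ℝ) + 1) ≤ q := by exact_mod_cast hm4
  have hpi := Real.pi_pos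
  have hgrid := cos_grid q m hq0 hm4
  set α : ℝ := 2 * π * m / q with hα
  set β : ℝ := 2 * π * (m + 1 : ℕ) / q with hβ
  have a0 : π / 2 ≤ α := by rw [hα, le_div_iff₀ hq']; nlinarith
  have a1 : α < 2 * π / 3 := by rw [hα, div_lt_iff₀ hq']; nlinarith
  have b0 : 2 * π / 3 < β := by rw [hβ, lt_div_iff₀ hq']; push_cast; nlinarith
  have b1 : β ≤ π := by rw [hβ, div_le_iff₀ hq']; push_cast; nlinarith
  have c23 : Real.cos (2 * π / 3) = -1 / 2 := by
    have : 2 * π / 3 = π - π / 3 := by ring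
    rw [this, Real.cos_pi_sub, Real.cos_pi_div_three]; ring
  have ca0 : Real.cos α ≤ 0 := by
    rw [← Real.cos_pi_div_two]
    exact Real.cos_le_cos_of_nonneg_of_le_pi (by linarith) (by linarith) a0
  have ca1 : -1 / 2 < Real.cos α := by
    rw [← c23]
    exact Real.cos_lt_cos_of_nonneg_of_le_pi (by linarith) (by linarith) a1
  have cb : Real.cos β < -1 / 2 := by
    rw [← c23]
    exact Real.cos_lt_cos_of_nonneg_of_le_pi (by linarith) (by linarith) b0
  have ka : ∃ a : ℕ, q * α = a * (2 * π) := ⟨m, by rw [hα]; field_simp⟩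
  have kb : ∃ a : ℕ, q * β = a * (2 * π) := ⟨m + 1, by rw [hβ]; field_simp⟩
  generalize hu : Real.cos α = u at *
  generalize hv : Real.cos β = v at *
  have hD : 0 < 1 + 2 * u * v := by nlinarith
  have huv : 0 < u - v := by linarith
  have hD' := hD.ne'
  have huv' := huv.ne'
  have hcomb : ∀ A B E D x y : ℝ, E ≠ 0 → D ≠ 0 → E * D + A * x + B * y = 0 →
      1 + 2 * (A / (2 * E * D)) * x + 2 * (B / (2 * E * D)) * y = 0 := by
    intro A B E D x y hE hD h
    have : 1 + 2 * (A / (2 * E * D)) * x + 2 * (B / (2 * E * D)) * y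
        = (E * D + A * x + B * y) / (E * D) := by
      field_simp
    rw [this, h, zero_div]
  have hw1 : 0 ≤ (1 - v) * (-(1 + 2 * v)) / (2 * (u - v) * (1 + 2 * u * v)) := by
    apply div_nonneg
    · apply mul_nonneg <;> linarith
    · positivity
  have hw2 : 0 ≤ (1 - u) * (1 + 2 * u) / (2 * (u - v) * (1 + 2 * u * v)) := by
    apply div_nonneg
    · apply mul_nonneg <;> linarith
    · positivity
  have hcm := cK_mem q hq α β _ _ hw1 hw2 (by rw [hu]; linarith) (by rw [hv]; linarith) ka kb
    (by rw [hu, hv]; exact hcomb _ _ _ _ _ _ huv' hD' (by ring))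
    (by rw [hu, hv]; exact hcomb _ _ _ _ _ _ huv' hD' (by ring))
  have htm := turan_mem q hq (-(u + v) / (1 + 2 * u * v)) (1 / (2 * (1 + 2 * u * v))) (by
    intro n
    have : 1 + 2 * (-(u + v) / (1 + 2 * u * v)) * Real.cos (2 * π * n / q)
      + 2 * (1 / (2 * (1 + 2 * u * v))) * (2 * Real.cos (2 * π * n / q) ^ 2 - 1)
      = 2 * ((Real.cos (2 * π * n / q) - u) * (Real.cos (2 * π * n / q) - v)) / (1 + 2 * u * v) := by
      field_simp; ring
    rw [this]
    apply div_nonneg _ hD.le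
    rcases hgrid n with h | h
    · have := mul_nonneg (sub_nonneg.2 h) (by linarith : 0 ≤ Real.cos (2 * π * n / q) - v)
      linarith
    · have := mul_nonneg (sub_nonneg.2 h) (by linarith : 0 ≤ u - Real.cos (2 * π * n / q))
      linarith)
  refine delta_le_of_mem _ _ _ _ hcm htm ?_
  simp only [cK, Finsupp.onFinset_apply, hK, eK, if_pos hq0, if_true]
  simp only [Nat.cast_zero, mul_zero, zero_mul, zero_div, Real.cos_zero, sub_zero]
  field_simp
  ring
end

section
/- Let q ∈ ℕ with q ≥ 7 and gcd(3, q) = 1. Then the infimum defining δ(K⁰_{3,q}) is attained: there exists a trigonometric polynomial T ∈ 𝐓(K⁰_{3,q}) whose constant coefficient T₀ equals δ(K⁰_{3,q}), where K⁰_{3,q} = {3, 4, …, q−3}. -/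
open Real

lemma aux_int (n : ℤ) : (∫ x in (0:ℝ)..1, Real.cos (2 * π * n * x)) = if n = 0 then 1 else 0 := by
  split_ifs with h
  · subst h; simp
  · have h' : (2 * π * (n:ℝ)) ≠ 0 := by
      have : (n:ℝ) ≠ 0 := by exact_mod_cast h
      positivity
    rw [intervalIntegral.integral_comp_mul_left (fun y => Real.cos y) h']
    have : Real.sin (2 * π * n) = 0 := by
      have := Real.sin_int_mul_pi (2 * n)
      rw [← this]; congr 1; push_cast; ring
    simp [this]

lemma aux_int2 (k m : ℕ) (hm : m ≠ 0) :
    (∫ x in (0:ℝ)..1, Real.cos (2 * π * k * x) * Real.cos (2 * π * m * x))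
      = if k = m then 1 / 2 else 0 := by
  have e : ∀ x : ℝ, Real.cos (2 * π * k * x) * Real.cos (2 * π * m * x)
      = 1 / 2 * Real.cos (2 * π * ((k + m : ℤ) : ℝ) * x)
        + 1 / 2 * Real.cos (2 * π * ((k - m : ℤ) : ℝ) * x) := by
    intro x
    have h1 : 2 * π * ((k + m : ℤ) : ℝ) * x = 2 * π * k * x + 2 * π * m * x := by
      push_cast; ring
    have h2 : 2 * π * ((k - m : ℤ) : ℝ) * x = 2 * π * k * x - 2 * π * m * x := by
      push_cast; ring
    rw [h1, h2, Real.cos_add, Real.cos_sub]; ring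
  simp_rw [e]
  rw [intervalIntegral.integral_add
    (Continuous.intervalIntegrable (by fun_prop) _ _)
    (Continuous.intervalIntegrable (by fun_prop) _ _),
    intervalIntegral.integral_const_mul, intervalIntegral.integral_const_mul, aux_int, aux_int]
  have h3 : ¬ ((k:ℤ) + m = 0) := by omega
  by_cases hk : k = m
  · subst hk; simp [h3]
  · have h4 : ¬ ((k:ℤ) - m = 0) := by omega
    simp [h3, h4, hk]

lemma aux_bound (N : ℕ) (hN : 0 < N) (v : ℕ → ℝ)
    (hv : ∀ x : ℝ, 0 ≤ ∑ k ∈ Finset.range N, v k * Real.cos (2 * π * k * x))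
    (m : ℕ) (hm : m ≠ 0) (hmN : m < N) (s : ℝ) (hs : |s| ≤ 1) : 0 ≤ v 0 + s * v m / 2 := by
  have h0 : 0 ≤ ∫ x in (0:ℝ)..1, (∑ k ∈ Finset.range N, v k * Real.cos (2 * π * k * x))
      * (1 + s * Real.cos (2 * π * m * x)) := by
    apply intervalIntegral.integral_nonneg (by norm_num)
    intro x _
    apply mul_nonneg (hv x)
    have : |s * Real.cos (2 * π * m * x)| ≤ 1 := by
      rw [abs_mul]
      exact mul_le_one₀ hs (abs_nonneg _) (Real.abs_cos_le_one _)
    linarith [(abs_le.mp this).1]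
  have e : ∀ x : ℝ, (∑ k ∈ Finset.range N, v k * Real.cos (2 * π * k * x))
      * (1 + s * Real.cos (2 * π * m * x)) = ∑ k ∈ Finset.range N,
        (v k * Real.cos (2 * π * ((k : ℤ) : ℝ) * x)
          + (v k * s) * (Real.cos (2 * π * k * x) * Real.cos (2 * π * m * x))) := by
    intro x
    rw [Finset.sum_mul]
    apply Finset.sum_congr rfl
    intros; push_cast; ring
  simp_rw [e] at h0
  rw [intervalIntegral.integral_finsetSum
    (fun k _ => Continuous.intervalIntegrable (by fun_prop) _ _)] at h0
  have e2 : ∀ k ∈ Finset.range N, (∫ x in (0:ℝ)..1, (v k * Real.cos (2 * π * ((k : ℤ) : ℝ) * x)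
          + (v k * s) * (Real.cos (2 * π * k * x) * Real.cos (2 * π * m * x))))
      = (if k = 0 then v k else 0) + (if k = m then v k * s / 2 else 0) := by
    intro k _
    rw [intervalIntegral.integral_add
      (Continuous.intervalIntegrable (by fun_prop) _ _)
      (Continuous.intervalIntegrable (by fun_prop) _ _),
      intervalIntegral.integral_const_mul, intervalIntegral.integral_const_mul, aux_int,
      aux_int2 k m hm]
    by_cases h1 : k = 0 <;> by_cases h2 : k = m <;> simp [h1, h2] <;> ring_nf
  rw [Finset.sum_congr rfl e2, Finset.sum_add_distrib] at h0
  simp [hN, hmN] at h0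
  linarith

lemma aux_eval (N : ℕ) (c : ℕ →₀ ℝ) (hc : ∀ k, c k ≠ 0 → k < N) (x : ℝ) :
    trigEval c x = ∑ k ∈ Finset.range N, c k * Real.cos (2 * π * k * x) := by
  unfold trigEval
  apply Finsupp.sum_of_support_subset
  · intro k hk
    simpa using hc k (by simpa using hk)
  · simp

/-- For `q ≥ 7`, `gcd(3, q) = 1`, the infimum defining `δ(K⁰_{3,q})` is attained:
there is a polynomial of the class `𝐓(K⁰_{3,q})` whose constant coefficient
equals `δ(K⁰_{3,q})`. -/
theorem stmt_10 (q : ℕ) (hq : 7 ≤ q) (hgcd : Nat.gcd 3 q = 1) :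
    ∃ c ∈ TrigClass (Kset0 3 q), c 0 = delta (Kset0 3 q) := by
  have hK : ∀ k, k ∈ Kset0 3 q → k < q := by
    intro k hk
    have := hk.2
    omega
  let S : Set (ℕ → ℝ) := {v | (∀ k, k ≠ 0 → k ∉ Kset0 3 q → v k = 0) ∧
    (∀ x : ℝ, 0 ≤ ∑ k ∈ Finset.range q, v k * Real.cos (2 * π * k * x)) ∧
    (∑ k ∈ Finset.range q, v k * Real.cos (2 * π * k * 0)) = 1 ∧ v 0 ≤ 1}
  have hclosed : IsClosed S := by
    have h1 : IsClosed {v : ℕ → ℝ | ∀ k, k ≠ 0 → k ∉ Kset0 3 q → v k = 0} := by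
      simp only [Set.ofPred_forall]
      refine isClosed_iInter fun k => isClosed_iInter fun _ => isClosed_iInter fun _ => ?_
      exact isClosed_eq (by fun_prop) (by fun_prop)
    have h2 : IsClosed {v : ℕ → ℝ | ∀ x : ℝ, 0 ≤ ∑ k ∈ Finset.range q,
        v k * Real.cos (2 * π * k * x)} := by
      simp only [Set.ofPred_forall]
      exact isClosed_iInter fun x => isClosed_le (by fun_prop) (by fun_prop)
    have h3 : IsClosed {v : ℕ → ℝ | (∑ k ∈ Finset.range q,
        v k * Real.cos (2 * π * k * 0)) = 1} := isClosed_eq (by fun_prop) (by fun_prop)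
    have h4 : IsClosed {v : ℕ → ℝ | v 0 ≤ 1} := isClosed_le (by fun_prop) (by fun_prop)
    exact h1.inter (h2.inter (h3.inter h4))
  have hsub : S ⊆ Set.univ.pi fun _ : ℕ => Set.Icc (-2 : ℝ) 2 := by
    rintro v ⟨hv1, hv2, hv3, hv4⟩ k -
    by_cases hk : k = 0
    · subst hk
      have := aux_bound q (by omega) v hv2 1 one_ne_zero (by omega) 0 (by simp)
      constructor <;> linarith
    · by_cases hk' : k ∈ Kset0 3 q
      · have a1 := aux_bound q (by omega) v hv2 k hk (hK k hk') 1 (by simp)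
        have a2 := aux_bound q (by omega) v hv2 k hk (hK k hk') (-1) (by simp)
        constructor <;> linarith
      · rw [hv1 k hk hk']; norm_num
  have hcomp : IsCompact S :=
    (isCompact_univ_pi fun _ => isCompact_Icc).of_isClosed_subset hclosed hsub
  have hne : S.Nonempty := by
    have hq0 : q ≠ 0 := by omega
    refine ⟨fun k => if k = 0 then 1 else 0, ?_, ?_, ?_, ?_⟩
    · intro k hk _; simp [hk]
    · intro x; simp [Nat.pos_of_ne_zero hq0]
    · simp [hq0]
    · simp
  obtain ⟨v, hvS, hmin⟩ := hcomp.exists_isMinOn hne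
    (f := fun v : ℕ → ℝ => v 0) (by fun_prop)
  have hvN : ∀ k, v k ≠ 0 → k ∈ Finset.range q := by
    intro k hk
    rw [Finset.mem_range]
    by_cases h0 : k = 0
    · omega
    · by_contra h
      exact hk (hvS.1 k h0 fun h' => h (hK k h'))
  have hev : ∀ x, trigEval (Finsupp.onFinset (Finset.range q) v hvN) x
      = ∑ k ∈ Finset.range q, v k * Real.cos (2 * π * k * x) := by
    intro x
    rw [aux_eval q _ (fun k hk => Finset.mem_range.mp (hvN k (by simpa using hk)))]
    simp
  have hmem : Finsupp.onFinset (Finset.range q) v hvN ∈ TrigClass (Kset0 3 q) := by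
    refine ⟨?_, ?_, ?_⟩
    · intro k hk hck
      by_contra h
      exact hck (by simpa using hvS.1 k hk h)
    · intro x; rw [hev]; exact hvS.2.1 x
    · rw [hev]; exact hvS.2.2.1
  refine ⟨_, hmem, ?_⟩
  have hleast : IsLeast ((fun c : ℕ →₀ ℝ => c 0) '' TrigClass (Kset0 3 q))
      ((Finsupp.onFinset (Finset.range q) v hvN) 0) := by
    refine ⟨⟨_, hmem, rfl⟩, ?_⟩
    rintro _ ⟨c, ⟨hc1, hc2, hc3⟩, rfl⟩
    have hcN : ∀ k, c k ≠ 0 → k < q := by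
      intro k hk
      by_cases h0 : k = 0
      · omega
      · exact hK k (hc1 k h0 hk)
    by_cases h1 : c 0 ≤ 1
    · have : (c : ℕ → ℝ) ∈ S := by
        refine ⟨?_, ?_, ?_, h1⟩
        · intro k hk hk'
          by_contra h
          exact hk' (hc1 k hk h)
        · intro x; rw [← aux_eval q c hcN]; exact hc2 x
        · rw [← aux_eval q c hcN]; exact hc3
      simpa using hmin this
    · have := hvS.2.2.2
      simp only [Finsupp.onFinset_apply]
      linarith
  exact hleast.csInf_eq.symm
end

section
/- Let q ∈ ℕ with q ≥ 7 and gcd(3, q) = 1, set r₀ = ⌊q/3⌋, and let γ₀, γ₁, γ₂ be the (unique) solution of the linear system γ₀ + γ₁ + γ₂ = 1, γ₀ + γ₁cos(2πr₀/q) + γ₂cos(2π(r₀+1)/q) = 0, γ₀ + γ₁cos(4πr₀/q) + γ₂cos(4π(r₀+1)/q) = 0. Define, for ν ∈ ℤ, Γ(ν) = γ₀ + γ₁cos(2πr₀ν/q) + γ₂cos(2π(r₀+1)ν/q), and let F(x) = ((sin(πqx))/(q·sin(πx)))² be the Fejér polynomial with cosine coefficients F_ν = (2/q)(1 − ν/q)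 for 1 ≤ ν ≤ q−1 and F₀ = 1/q. Then the polynomial T*(x) = Σ_{ν=0}^{q−1} γ₀⁻¹Γ(ν)F_ν cos(2πνx) satisfies: T*(x) ≥ 0 for all x ∈ ℝ, T*(0) = 1, its cosine coefficients vanish for all indices ν ∈ {1, …, q−1} outside {3, 4, …, q−3}, and its constant coefficient equals 1/(qγ₀). -/
open Real

/-- `Γ(ν) = γ₀ + γ₁·cos(2πr₀ν/q) + γ₂·cos(2π(r₀+1)ν/q)`. -/
noncomputable def Gam (q r₀ : ℕ) (γ₀ γ₁ γ₂ : ℝ) (ν : ℕ) : ℝ :=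
  γ₀ + γ₁ * Real.cos (2 * π * r₀ * ν / q) + γ₂ * Real.cos (2 * π * (r₀ + 1) * ν / q)

/-- Cosine coefficients of the Fejér polynomial
`F(x) = (sin(πqx)/(q·sin(πx)))² = (1/q)(1 + 2Σ_{ν=1}^{q−1}(1 − ν/q)cos(2πνx))`:
`F₀ = 1/q` and `F_ν = (2/q)(1 − ν/q)` for `ν ≥ 1`. -/
noncomputable def fejerCoef (q ν : ℕ) : ℝ :=
  if ν = 0 then 1 / q else (2 / q) * (1 - (ν : ℝ) / q)

/-- The polynomial `T*(x) = Σ_{ν=0}^{q−1} γ₀⁻¹·Γ(ν)·F_ν·cos(2πνx)`. -/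
noncomputable def Tstar (q r₀ : ℕ) (γ₀ γ₁ γ₂ : ℝ) (x : ℝ) : ℝ :=
  ∑ ν ∈ Finset.range q, γ₀⁻¹ * Gam q r₀ γ₀ γ₁ γ₂ ν * fejerCoef q ν * Real.cos (2 * π * ν * x)

/-- Fejer identity. -/
lemma fejer_aux (y : ℝ) (n : ℕ) :
    2 * ∑ k ∈ Finset.range n, ((n : ℝ) - k) * Real.cos (k * y) - n
      = (∑ k ∈ Finset.range n, Real.cos (k * y)) ^ 2
        + (∑ k ∈ Finset.range n, Real.sin (k * y)) ^ 2 := by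
  induction n with
  | zero => simp
  | succ n ih =>
    have e1 : ∑ k ∈ Finset.range (n + 1), (((n + 1 : ℕ) : ℝ) - k) * Real.cos (k * y)
        = ∑ k ∈ Finset.range n, ((n : ℝ) - k) * Real.cos (k * y)
          + ∑ k ∈ Finset.range (n + 1), Real.cos (k * y) := by
      rw [Finset.sum_range_succ, Finset.sum_range_succ, ← add_assoc, ← Finset.sum_add_distrib]
      congr 1
      · apply Finset.sum_congr rfl
        intro k _
        push_cast
        ring
      · push_cast
        ring
    have e2 : ∑ k ∈ Finset.range (n + 1), Real.cos (k * y)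
        = 1 + Real.cos (n * y) * ∑ k ∈ Finset.range n, Real.cos (k * y)
          + Real.sin (n * y) * ∑ k ∈ Finset.range n, Real.sin (k * y) := by
      rw [Finset.sum_range_succ', ← Finset.sum_range_reflect, Finset.mul_sum, Finset.mul_sum,
        add_assoc, ← Finset.sum_add_distrib, add_comm]
      congr 1
      · simp
      · apply Finset.sum_congr rfl
        intro k hk
        rw [← Real.cos_sub]
        have hk' := Finset.mem_range.1 hk
        have : n - 1 - k + 1 = n - k := by omega
        rw [this, Nat.cast_sub hk'.le, sub_mul]
    rw [e1]
    have hcs := Real.sin_sq_add_cos_sq (n * y)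
    have e3 := e2
    rw [Finset.sum_range_succ] at e3
    rw [Finset.sum_range_succ, Finset.sum_range_succ]
    push_cast
    linear_combination ih + 2 * e3 - hcs

/-- Fejer kernel as a cosine sum. -/
noncomputable def fejS (q : ℕ) (y : ℝ) : ℝ :=
  ∑ ν ∈ Finset.range q, fejerCoef q ν * Real.cos (ν * y)

lemma fejS_eq (q : ℕ) (hq : 0 < q) (y : ℝ) :
    (q : ℝ) ^ 2 * fejS q y = (∑ k ∈ Finset.range q, Real.cos (k * y)) ^ 2
        + (∑ k ∈ Finset.range q, Real.sin (k * y)) ^ 2 := by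
  have hq0 : (q : ℝ) ≠ 0 := by positivity
  rw [← fejer_aux, fejS, Finset.mul_sum, Finset.mul_sum]
  obtain ⟨m, rfl⟩ : ∃ m, q = m + 1 := ⟨q - 1, by omega⟩
  rw [Finset.sum_range_succ', Finset.sum_range_succ' (fun k : ℕ => 2 * ((((m + 1 : ℕ) : ℝ) - k) * Real.cos (k * y)))]
  have : ∑ k ∈ Finset.range m, (((m + 1 : ℕ) : ℝ)) ^ 2 * (fejerCoef (m + 1) (k + 1) * Real.cos (((k + 1 : ℕ) : ℝ) * y))
      = ∑ k ∈ Finset.range m, 2 * ((((m + 1 : ℕ) : ℝ) - ((k + 1 : ℕ) : ℝ)) * Real.cos (((k + 1 : ℕ) : ℝ) * y)) := by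
    apply Finset.sum_congr rfl
    intro k _
    rw [fejerCoef, if_neg (by omega)]
    field_simp
  rw [this]
  generalize ∑ k ∈ Finset.range m, 2 * ((((m + 1 : ℕ) : ℝ) - ((k + 1 : ℕ) : ℝ)) * Real.cos (((k + 1 : ℕ) : ℝ) * y)) = A
  simp only [fejerCoef, if_true, Nat.cast_zero, zero_mul, Real.cos_zero]
  field_simp
  ring

lemma fejS_nonneg (q : ℕ) (hq : 0 < q) (y : ℝ) : 0 ≤ fejS q y := by
  have h := fejS_eq q hq y
  have hq0 : (0 : ℝ) < (q : ℝ) ^ 2 := by positivity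
  have : 0 ≤ (q : ℝ) ^ 2 * fejS q y := by rw [h]; positivity
  exact nonneg_of_mul_nonneg_right this hq0

lemma fejS_zero (q : ℕ) (hq : 0 < q) : fejS q 0 = 1 := by
  have h := fejS_eq q hq 0
  have hq0 : (q : ℝ) ^ 2 ≠ 0 := by positivity
  simp at h
  exact mul_left_cancel₀ hq0 (by rw [h, mul_one])

lemma fejS_node (q : ℕ) (hq : 0 < q) (j : ℕ) (y : ℝ) (hy : y * q = j * (2 * π))
    (hc : Real.cos y ≠ 1) : fejS q y = 0 := by
  have h := fejS_eq q hq y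
  have hq0 : (q : ℝ) ^ 2 ≠ 0 := by positivity
  set z : ℂ := Complex.exp (y * Complex.I) with hz
  have hpow : ∀ k : ℕ, z ^ k = ((Real.cos (k * y) : ℝ) : ℂ) + ((Real.sin (k * y) : ℝ) : ℂ) * Complex.I := by
    intro k
    rw [hz, ← Complex.exp_nat_mul, ← mul_assoc, Complex.exp_mul_I]
    push_cast
    rfl
  have hz1 : z - 1 ≠ 0 := by
    intro hh
    have h1 := hpow 1
    rw [pow_one, sub_eq_zero.1 hh] at h1
    have := congrArg Complex.re h1
    simp at this
    exact hc this.symm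
  have hzq : z ^ q = 1 := by
    rw [hpow, mul_comm (q : ℝ) y, hy, Real.cos_nat_mul_two_pi]
    have : Real.sin (j * (2 * π)) = 0 := by
      have := Real.sin_nat_mul_pi (j * 2)
      push_cast at this
      rw [← this]
      ring_nf
    rw [this]
    simp
  have hg : ∑ k ∈ Finset.range q, z ^ k = 0 := by
    have := geom_sum_mul z q
    rw [hzq, sub_self] at this
    exact (mul_eq_zero.1 this).resolve_right hz1
  simp only [hpow] at hg
  have hre := congrArg Complex.re hg
  have him := congrArg Complex.im hg
  rw [Complex.re_sum] at hre
  rw [Complex.im_sum] at him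
  simp only [Complex.add_re, Complex.add_im, Complex.ofReal_re, Complex.ofReal_im,
    Complex.mul_re, Complex.mul_im, Complex.I_re, Complex.I_im, mul_zero, mul_one, sub_zero,
    zero_mul, add_zero, zero_add, Complex.zero_re, Complex.zero_im] at hre him
  rw [hre, him] at h
  simpa [hq.ne'] using h

lemma Tstar_eq (q r₀ : ℕ) (γ₀ γ₁ γ₂ : ℝ) (x : ℝ) :
    Tstar q r₀ γ₀ γ₁ γ₂ x = γ₀⁻¹ * (γ₀ * fejS q (2 * π * x)
      + γ₁ / 2 * (fejS q (2 * π * x + 2 * π * r₀ / q) + fejS q (2 * π * x - 2 * π * r₀ / q))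
      + γ₂ / 2 * (fejS q (2 * π * x + 2 * π * (r₀ + 1) / q)
        + fejS q (2 * π * x - 2 * π * (r₀ + 1) / q))) := by
  unfold Tstar fejS
  simp only [← Finset.sum_add_distrib, Finset.mul_sum]
  apply Finset.sum_congr rfl
  intro k _
  have a1 : ∀ t : ℝ, Real.cos (k * (2 * π * x + t)) + Real.cos (k * (2 * π * x - t))
      = 2 * Real.cos (2 * π * k * x) * Real.cos (t * k) := by
    intro t
    rw [mul_add, mul_sub, Real.cos_add, Real.cos_sub, show (k : ℝ) * (2 * π * x) = 2 * π * k * x by ring,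
      mul_comm (k : ℝ) t]
    ring
  have b1 := a1 (2 * π * r₀ / q)
  have b2 := a1 (2 * π * (r₀ + 1) / q)
  rw [show 2 * π * r₀ / q * (k : ℝ) = 2 * π * r₀ * k / q by ring] at b1
  rw [show 2 * π * (r₀ + 1) / q * (k : ℝ) = 2 * π * (r₀ + 1) * k / q by ring] at b2
  rw [show (k : ℝ) * (2 * π * x) = 2 * π * k * x by ring]
  unfold Gam
  linear_combination (-γ₀⁻¹ * fejerCoef q k * γ₁ / 2) * b1 - (γ₀⁻¹ * fejerCoef q k * γ₂ / 2) * b2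

lemma Gam_reflect (q r₀ : ℕ) (hq : 0 < q) (γ₀ γ₁ γ₂ : ℝ) (ν : ℕ) (hν : ν ≤ q) :
    Gam q r₀ γ₀ γ₁ γ₂ (q - ν) = Gam q r₀ γ₀ γ₁ γ₂ ν := by
  have hq0 : (q : ℝ) ≠ 0 := by positivity
  have key : ∀ m : ℕ, Real.cos (2 * π * m * ((q : ℝ) - ν) / q) = Real.cos (2 * π * m * ν / q) := by
    intro m
    rw [← Real.cos_nat_mul_two_pi_sub _ m]
    congr 1
    field_simp
    ring
  unfold Gam
  have k2 := key (r₀ + 1)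
  push_cast at k2
  rw [Nat.cast_sub hν, key, k2]

/-- For `q ≥ 7`, `gcd(3, q) = 1`, `r₀ = ⌊q/3⌋`, and `γ₀, γ₁, γ₂` the solution of the
linear system `Γ(0) = 1`, `Γ(1) = Γ(2) = 0`, the polynomial
`T*(x) = Σ_{ν=0}^{q−1} γ₀⁻¹Γ(ν)F_ν cos(2πνx)` satisfies: `T*(x) ≥ 0` for all `x`,
`T*(0) = 1`, its cosine coefficients vanish for indices `ν ∈ {1, …, q−1}` outside
`{3, …, q−3}`, and its constant coefficient equals `1/(qγ₀)`. -/
theorem stmt_11 (q : ℕ) (hq : 7 ≤ q) (hgcd : Nat.gcd 3 q = 1)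
    (r₀ : ℕ) (hr : r₀ = q / 3) (γ₀ γ₁ γ₂ : ℝ)
    (h1 : γ₀ + γ₁ + γ₂ = 1)
    (h2 : γ₀ + γ₁ * Real.cos (2 * π * r₀ / q) + γ₂ * Real.cos (2 * π * (r₀ + 1) / q) = 0)
    (h3 : γ₀ + γ₁ * Real.cos (4 * π * r₀ / q) + γ₂ * Real.cos (4 * π * (r₀ + 1) / q) = 0)
    (huniq : ∀ β₀ β₁ β₂ : ℝ,
      β₀ + β₁ + β₂ = 1 →
      β₀ + β₁ * Real.cos (2 * π * r₀ / q) + β₂ * Real.cos (2 * π * (r₀ + 1) / q) = 0 →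
      β₀ + β₁ * Real.cos (4 * π * r₀ / q) + β₂ * Real.cos (4 * π * (r₀ + 1) / q) = 0 →
      β₀ = γ₀ ∧ β₁ = γ₁ ∧ β₂ = γ₂) :
    (∀ x : ℝ, 0 ≤ Tstar q r₀ γ₀ γ₁ γ₂ x) ∧
    Tstar q r₀ γ₀ γ₁ γ₂ 0 = 1 ∧
    (∀ ν : ℕ, 1 ≤ ν → ν ≤ q - 1 → (ν < 3 ∨ q - 3 < ν) →
      γ₀⁻¹ * Gam q r₀ γ₀ γ₁ γ₂ ν * fejerCoef q ν = 0) ∧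
    γ₀⁻¹ * Gam q r₀ γ₀ γ₁ γ₂ 0 * fejerCoef q 0 = 1 / (q * γ₀) := by
  have hq0 : 0 < q := by omega
  have hqr : (0 : ℝ) < q := by exact_mod_cast hq0
  have hπ := Real.pi_pos
  have hm : q = 3 * r₀ + 1 ∨ q = 3 * r₀ + 2 := by
    have : q % 3 ≠ 0 := by
      intro h
      rw [Nat.gcd_eq_left (Nat.dvd_of_mod_eq_zero h)] at hgcd
      omega
    omega
  have n1 : (3 * r₀ : ℝ) < q := by exact_mod_cast (show 3 * r₀ < q by omega)
  have n2 : (q : ℝ) < 3 * (r₀ + 1) := by exact_mod_cast (show q < 3 * (r₀ + 1) by omega)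
  have n3 : (q : ℝ) ≤ 4 * r₀ := by exact_mod_cast (show q ≤ 4 * r₀ by omega)
  have n4 : 2 * ((r₀ : ℝ) + 1) ≤ q := by exact_mod_cast (show 2 * (r₀ + 1) ≤ q by omega)
  have c23 : Real.cos (2 * π / 3) = -1 / 2 := by
    rw [show 2 * π / 3 = π - π / 3 by ring, Real.cos_pi_sub, Real.cos_pi_div_three]
    norm_num
  have ha1 : -1 / 2 < Real.cos (2 * π * r₀ / q) := by
    rw [← c23]
    apply Real.cos_lt_cos_of_nonneg_of_le_pi (by positivity) (by linarith)
    rw [div_lt_div_iff₀ hqr (by norm_num)]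
    nlinarith
  have ha2 : Real.cos (2 * π * r₀ / q) ≤ 0 := by
    apply Real.cos_nonpos_of_pi_div_two_le_of_le
    · rw [div_le_div_iff₀ (by norm_num) hqr]
      nlinarith
    · rw [div_le_iff₀ hqr]
      nlinarith
  have hb1 : Real.cos (2 * π * (r₀ + 1) / q) < -1 / 2 := by
    rw [← c23]
    apply Real.cos_lt_cos_of_nonneg_of_le_pi (by positivity)
    · rw [div_le_iff₀ hqr]
      nlinarith
    · rw [div_lt_div_iff₀ (by norm_num) hqr]
      nlinarith
  have hA2 : Real.cos (4 * π * r₀ / q) = 2 * Real.cos (2 * π * r₀ / q) ^ 2 - 1 := by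
    rw [← Real.cos_two_mul]
    congr 1
    ring
  have hB2 : Real.cos (4 * π * (r₀ + 1) / q) = 2 * Real.cos (2 * π * (r₀ + 1) / q) ^ 2 - 1 := by
    rw [← Real.cos_two_mul]
    congr 1
    ring
  have G1 : Gam q r₀ γ₀ γ₁ γ₂ 1 = 0 := by
    rw [← h2]
    simp [Gam]
  have G2 : Gam q r₀ γ₀ γ₁ γ₂ 2 = 0 := by
    rw [← h3]
    unfold Gam
    push_cast
    ring_nf
  rw [hA2, hB2] at h3
  have f1 : fejS q (2 * π * r₀ / q) = 0 := by
    apply fejS_node q hq0 r₀ _ _ (by linarith)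
    field_simp
  have f2 : fejS q (2 * π * (r₀ + 1) / q) = 0 := by
    apply fejS_node q hq0 (r₀ + 1) _ _ (by linarith)
    push_cast
    field_simp
  have hneg : ∀ y, fejS q (-y) = fejS q y := by
    intro y
    simp [fejS]
  have hT : ∀ x, 0 ≤ fejS q x := fejS_nonneg q hq0
  have hTe := Tstar_eq q r₀ γ₀ γ₁ γ₂
  generalize Real.cos (2 * π * r₀ / q) = a at *
  generalize Real.cos (2 * π * (r₀ + 1) / q) = b at *
  have g0 : 0 < γ₀ := by
    have e : γ₀ * ((1 - a) * (1 - b)) = 1 / 2 + a * b := by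
      linear_combination (a * b - 1/2 + 1) * h1 - (a + b) * h2 + (1 / 2) * h3
    have p : 0 < (1 - a) * (1 - b) := mul_pos (by linarith) (by linarith)
    have : 0 < γ₀ * ((1 - a) * (1 - b)) := by
      rw [e]
      nlinarith
    exact pos_of_mul_pos_left this p.le
  have g1 : 0 < γ₁ := by
    have e : γ₁ * ((1 - a) * (a - b)) = -(1 / 2 + b) := by
      linear_combination -((b + 1/2) * h1 - (1 + b) * h2 + (1 / 2) * h3)
    have p : 0 < (1 - a) * (a - b) := mul_pos (by linarith) (by linarith)
    have : 0 < γ₁ * ((1 - a) * (a - b)) := by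
      rw [e]
      linarith
    exact pos_of_mul_pos_left this p.le
  have g2 : 0 < γ₂ := by
    have e : γ₂ * ((1 - b) * (a - b)) = 1 / 2 + a := by
      linear_combination ((a + 1/2) * h1 - (1 + a) * h2 + (1 / 2) * h3)
    have p : 0 < (1 - b) * (a - b) := mul_pos (by linarith) (by linarith)
    have : 0 < γ₂ * ((1 - b) * (a - b)) := by
      rw [e]
      linarith
    exact pos_of_mul_pos_left this p.le
  refine ⟨?_, ?_, ?_, ?_⟩
  · intro x
    rw [hTe]
    have t1 := hT (2 * π * x)
    have t2 := hT (2 * π * x + 2 * π * r₀ / q)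
    have t3 := hT (2 * π * x - 2 * π * r₀ / q)
    have t4 := hT (2 * π * x + 2 * π * (r₀ + 1) / q)
    have t5 := hT (2 * π * x - 2 * π * (r₀ + 1) / q)
    positivity
  · rw [hTe]
    simp only [mul_zero, zero_add, zero_sub, hneg, f1, f2, fejS_zero q hq0]
    field_simp
    ring
  · intro ν hν1 hν2 hν
    have : Gam q r₀ γ₀ γ₁ γ₂ ν = 0 := by
      have hc : ν = 1 ∨ ν = 2 ∨ ν = q - 1 ∨ ν = q - 2 := by omega
      rcases hc with rfl | rfl | rfl | rfl
      · exact G1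
      · exact G2
      · rw [Gam_reflect q r₀ hq0 _ _ _ 1 (by omega), G1]
      · rw [Gam_reflect q r₀ hq0 _ _ _ 2 (by omega), G2]
    rw [this]
    ring
  · have : Gam q r₀ γ₀ γ₁ γ₂ 0 = 1 := by
      rw [← h1]
      simp [Gam]
    rw [this]
    simp only [fejerCoef, if_true]
    field_simp
end

section
/- Let q ∈ ℕ, q ≥ 2. Then δ({k ∈ ℕ : q ∤ k}) = 1/q. -/
open Real

lemma cos_sum_zero (q : ℕ) (hq : 2 ≤ q) (k : ℕ) (hk : ¬ q ∣ k) :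
    ∑ j ∈ Finset.range q, Real.cos (2 * π * k * ((j : ℝ) / q)) = 0 := by
  have hq0 : (q : ℂ) ≠ 0 := by
    have : q ≠ 0 := by omega
    exact_mod_cast this
  set z : ℂ := Complex.exp (2 * π * Complex.I * k / q) with hz
  have hz1 : z ≠ 1 := by
    intro h
    rw [hz, Complex.exp_eq_one_iff] at h
    obtain ⟨n, hn⟩ := h
    have hpi : (2 * π * Complex.I : ℂ) ≠ 0 := Complex.two_pi_I_ne_zero
    have h2 : (2 * π * Complex.I : ℂ) * k = (2 * π * Complex.I) * (n * q) := by
      field_simp at hn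
      linear_combination (2 * π * Complex.I : ℂ) * hn
    have h3 : (k : ℂ) = n * q := mul_left_cancel₀ hpi h2
    have h4 : (k : ℤ) = n * q := by exact_mod_cast h3
    apply hk
    have : (q : ℤ) ∣ k := ⟨n, by rw [h4]; ring⟩
    exact_mod_cast this
  have hzq : z ^ q = 1 := by
    rw [hz, ← Complex.exp_nat_mul, Complex.exp_eq_one_iff]
    exact ⟨k, by push_cast; field_simp⟩
  have hs : ∑ j ∈ Finset.range q, z ^ j = 0 := by
    rw [geom_sum_eq hz1, hzq]; simp
  have hre := congrArg Complex.re hs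
  rw [Complex.re_sum] at hre
  rw [Complex.zero_re] at hre
  rw [← hre]
  refine Finset.sum_congr rfl fun j _ => ?_
  rw [hz, ← Complex.exp_nat_mul, ← Complex.exp_ofReal_mul_I_re]
  congr 2
  push_cast
  ring

noncomputable def fejC (q : ℕ) : ℕ →₀ ℝ :=
  ∑ i ∈ Finset.range q, ∑ j ∈ Finset.range q,
    Finsupp.single ((i - j) + (j - i)) (1 / (q : ℝ) ^ 2)

lemma trigEval_sum (s : Finset ℕ) (f : ℕ → ℕ →₀ ℝ) (x : ℝ) :
    trigEval (∑ i ∈ s, f i) x = ∑ i ∈ s, trigEval (f i) x := by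
  unfold trigEval
  rw [Finsupp.sum_finsetSum_index]
  · intro a; simp
  · intro a b c; ring

lemma trigEval_fejC (q : ℕ) (x : ℝ) :
    trigEval (fejC q) x = 1 / (q : ℝ) ^ 2 *
      ((∑ i ∈ Finset.range q, Real.cos (2 * π * i * x)) ^ 2 +
       (∑ i ∈ Finset.range q, Real.sin (2 * π * i * x)) ^ 2) := by
  unfold fejC
  rw [trigEval_sum, sq (∑ i ∈ Finset.range q, Real.cos _),
    sq (∑ i ∈ Finset.range q, Real.sin _), Finset.sum_mul_sum, Finset.sum_mul_sum,
    ← Finset.sum_add_distrib, Finset.mul_sum]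
  refine Finset.sum_congr rfl fun i _ => ?_
  rw [trigEval_sum, ← Finset.sum_add_distrib, Finset.mul_sum]
  refine Finset.sum_congr rfl fun j _ => ?_
  unfold trigEval
  rw [Finsupp.sum_single_index (by simp), ← Real.cos_sub]
  congr 1
  rcases le_total i j with h | h
  · rw [Nat.sub_eq_zero_of_le h, zero_add, Nat.cast_sub h, ← Real.cos_neg]
    congr 1; ring
  · rw [Nat.sub_eq_zero_of_le h, add_zero, Nat.cast_sub h]
    congr 1; ring

lemma fejC_apply (q k : ℕ) : fejC q k = ∑ i ∈ Finset.range q, ∑ j ∈ Finset.range q,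
    if (i - j) + (j - i) = k then (1 / (q : ℝ) ^ 2) else 0 := by
  simp only [fejC, Finsupp.finsetSum_apply, Finsupp.single_apply]

/-- Example 1 (infinite part):  `δ({k ∈ ℕ : q ∤ k}) = 1/q` for `q ≥ 2`. -/
theorem stmt_13 (q : ℕ) (hq : 2 ≤ q) :
    delta {k : ℕ | ¬ q ∣ k} = 1 / q := by
  have hqpos : (0 : ℝ) < q := by
    have : 0 < q := by omega
    exact_mod_cast this
  have hleast : IsLeast ((fun c : ℕ →₀ ℝ => c 0) '' TrigClass {k : ℕ | ¬ q ∣ k}) (1 / q) := by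
    constructor
    · refine ⟨fejC q, ⟨?_, ?_, ?_⟩, ?_⟩
      · intro k hk0 hk hd
        apply hk
        rw [fejC_apply]
        refine Finset.sum_eq_zero fun i hi => Finset.sum_eq_zero fun j hj => ?_
        rw [Finset.mem_range] at hi hj
        have := Nat.le_of_dvd (Nat.pos_of_ne_zero hk0) hd
        rw [if_neg]
        omega
      · intro x
        rw [trigEval_fejC]
        positivity
      · rw [trigEval_fejC]
        simp
        field_simp
      · show fejC q 0 = 1 / q
        rw [fejC_apply]
        have : ∀ i ∈ Finset.range q, (∑ j ∈ Finset.range q,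
            if (i - j) + (j - i) = 0 then (1 / (q : ℝ) ^ 2) else 0) = 1 / (q : ℝ) ^ 2 := by
          intro i hi
          rw [Finset.sum_eq_single i]
          · simp
          · intro j _ hj
            rw [if_neg]; omega
          · intro h; exact absurd hi h
        rw [Finset.sum_congr rfl this]
        simp
        field_simp
    · rintro _ ⟨c, ⟨hc, hpos, h1⟩, rfl⟩
      show 1 / (q : ℝ) ≤ c 0
      have hsum : ∑ j ∈ Finset.range q, trigEval c ((j : ℝ) / q) = q * c 0 := by
        unfold trigEval Finsupp.sum
        rw [Finset.sum_comm, Finset.sum_eq_single 0]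
        · simp
        · intro k hk hk0
          rw [← Finset.mul_sum, cos_sum_zero q hq k (hc k hk0 (Finsupp.mem_support_iff.mp hk)),
            mul_zero]
        · intro h
          simp [Finsupp.notMem_support_iff.mp h]
      have hle : trigEval c (((0 : ℕ) : ℝ) / q) ≤
          ∑ j ∈ Finset.range q, trigEval c ((j : ℝ) / q) :=
        Finset.single_le_sum (f := fun j : ℕ => trigEval c ((j : ℝ) / q))
          (fun j _ => hpos _) (Finset.mem_range.mpr (by omega))
      rw [hsum, Nat.cast_zero, zero_div, h1] at hle
      rw [div_le_iff₀ hqpos]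
      linarith
  exact hleast.csInf_eq
end

section
/- δ({2, 3}) = cos(π/5)/(1 + cos(π/5)). -/
open Real

lemma trigEval_23 (c : ℕ →₀ ℝ) (h : ∀ k : ℕ, k ≠ 0 → c k ≠ 0 → k ∈ ({2, 3} : Set ℕ)) (x : ℝ) :
    trigEval c x = c 0 + c 2 * Real.cos (2 * (2 * π * x)) + c 3 * Real.cos (3 * (2 * π * x)) := by
  unfold trigEval
  rw [Finsupp.sum_of_support_subset c (s := ({0, 2, 3} : Finset ℕ))]
  · rw [Finset.sum_insert (by decide), Finset.sum_insert (by decide), Finset.sum_singleton]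
    have e2 : 2 * π * ((2 : ℕ) : ℝ) * x = 2 * (2 * π * x) := by push_cast; ring
    have e3 : 2 * π * ((3 : ℕ) : ℝ) * x = 3 * (2 * π * x) := by push_cast; ring
    rw [e2, e3]
    simp
    ring
  · intro k hk
    rw [Finsupp.mem_support_iff] at hk
    by_cases h0 : k = 0
    · simp [h0]
    · have := h k h0 hk
      simp at this ⊢
      tauto
  · intro i _
    simp

lemma ratio_eq : Real.cos (π / 5) / (1 + Real.cos (π / 5)) = √5 / 5 := by
  rw [Real.cos_pi_div_five]
  have h5 : √5 ^ 2 = 5 := Real.sq_sqrt (by norm_num)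
  have := Real.sqrt_nonneg 5
  rw [div_eq_div_iff (by positivity) (by norm_num)]
  nlinarith

noncomputable def extC : ℕ →₀ ℝ :=
  Finsupp.single 0 (√5 / 5) + Finsupp.single 2 (3 / 5 * (1 - √5 / 5))
    + Finsupp.single 3 (2 / 5 * (1 - √5 / 5))

lemma extC_mem : extC ∈ TrigClass {2, 3} := by
  have h5 : √5 ^ 2 = 5 := Real.sq_sqrt (by norm_num)
  have hn := Real.sqrt_nonneg 5
  have hlt : √5 < 5 := by nlinarith
  have hgt : 2 < √5 := by nlinarith
  have hs : ∀ k : ℕ, k ≠ 0 → extC k ≠ 0 → k ∈ ({2, 3} : Set ℕ) := by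
    intro k h0 hk
    by_contra hc
    simp only [Set.mem_insert_iff, Set.mem_singleton_iff, not_or] at hc
    apply hk
    simp [extC, Finsupp.single_apply, Ne.symm h0, Ne.symm hc.1, Ne.symm hc.2]
  have c0 : extC 0 = √5 / 5 := by simp [extC]
  have c2 : extC 2 = 3 / 5 * (1 - √5 / 5) := by simp [extC]
  have c3 : extC 3 = 2 / 5 * (1 - √5 / 5) := by simp [extC]
  refine ⟨hs, fun x => ?_, ?_⟩
  · rw [trigEval_23 _ hs, c0, c2, c3, Real.cos_two_mul, Real.cos_three_mul]
    have hy := Real.neg_one_le_cos (2 * π * x)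
    generalize Real.cos (2 * π * x) = y at *
    have key : √5 / 5 + 3 / 5 * (1 - √5 / 5) * (2 * y ^ 2 - 1)
        + 2 / 5 * (1 - √5 / 5) * (4 * y ^ 3 - 3 * y)
        = (1 - √5 / 5) / 5 * 8 * ((y - (√5 - 1) / 4) ^ 2 * (y + 1 / 4 + √5 / 2)) := by
      generalize √5 = s at *
      have h3 : s ^ 3 = 5 * s := by rw [pow_succ, h5]
      have h4 : s ^ 4 = 25 := by rw [show s ^ 4 = (s ^ 2) ^ 2 by ring, h5]; norm_num
      ring_nf
      rw [h4, h3, h5]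
      ring
    rw [key]
    have a1 : 0 ≤ 1 - √5 / 5 := by linarith
    have a2 : 0 ≤ y + 1 / 4 + √5 / 2 := by linarith
    positivity
  · rw [trigEval_23 _ hs, c0, c2, c3]
    simp
    ring

lemma lower (c : ℕ →₀ ℝ) (hc : c ∈ TrigClass {2, 3}) :
    Real.cos (π / 5) / (1 + Real.cos (π / 5)) ≤ c 0 := by
  obtain ⟨hs, hp, h1⟩ := hc
  have hx := hp (1 / 5)
  rw [trigEval_23 _ hs] at hx h1
  have e2 : Real.cos (2 * (2 * π * (1 / 5))) = - Real.cos (π / 5) := by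
    rw [← Real.cos_pi_sub]; congr 1; ring
  have e3 : Real.cos (3 * (2 * π * (1 / 5))) = - Real.cos (π / 5) := by
    rw [← Real.cos_add_pi]; congr 1; ring
  rw [e2, e3] at hx
  simp at h1
  have hpos : 0 < Real.cos (π / 5) := by rw [Real.cos_pi_div_five]; positivity
  rw [div_le_iff₀ (by linarith)]
  have : c 2 + c 3 = 1 - c 0 := by linarith
  have e : c 0 + c 2 * -Real.cos (π / 5) + c 3 * -Real.cos (π / 5)
    = c 0 - (c 2 + c 3) * Real.cos (π / 5) := by ring
  rw [e, this] at hx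
  linarith

/-- Example 2:  `δ({2, 3}) = cos(π/5)/(1 + cos(π/5))`. -/
theorem stmt_14 :
    delta ({2, 3} : Set ℕ) = Real.cos (π / 5) / (1 + Real.cos (π / 5)) := by
  have : IsLeast ((fun c : ℕ →₀ ℝ => c 0) '' TrigClass {2, 3})
      (Real.cos (π / 5) / (1 + Real.cos (π / 5))) := by
    refine ⟨⟨extC, extC_mem, ?_⟩, ?_⟩
    · rw [ratio_eq]; simp [extC]
    · rintro _ ⟨c, hc, rfl⟩
      exact lower c hc
  exact this.csInf_eq
end

section
/- Let p, q ∈ ℕ with 2p ≤ q and gcd(p, q) = 1, and suppose f ∈ K(p/q) and T ∈ 𝐓(K_{p,q}), where K_{p,q} = {qν + k : ν ∈ ℤ_{≥0}, k ∈ {p, p+1, …, q−p}}. Then the constant coefficient of T satisfies T₀ = Σ_{n=0}^∞ a_n T(n/q) ≥ a₀, where a_n are the cosine coefficients of f. -/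
open Real

/-- If `f ∈ K(p/q)` (with cosine coefficients `a`) and `T ∈ 𝐓(K_{p,q})`
(with coefficients `c`, constant coefficient `c 0`), then
`T₀ = Σ_{n=0}^∞ a_n T(n/q) ≥ a₀`. -/
theorem stmt_16 (p q : ℕ) (hp : 0 < p) (hpq : 2 * p ≤ q) (hgcd : Nat.gcd p q = 1)
    (a : ℕ → ℝ) (ha : a ∈ TuranClass (p / q))
    (c : ℕ →₀ ℝ) (hc : c ∈ TrigClass (Kset p q)) :
    c 0 = (∑' n : ℕ, a n * trigEval c (n / q)) ∧ a 0 ≤ c 0 := by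
  obtain ⟨ha0, hsum, hsum1, hf⟩ := ha
  obtain ⟨hK, hT, hT0⟩ := hc
  have hq : 0 < q := by omega
  have hqR : (0 : ℝ) < q := by exact_mod_cast hq
  have hS : ∀ x : ℝ, Summable (fun n : ℕ => a n * Real.cos (2 * π * n * x)) := by
    intro x
    refine Summable.of_norm_bounded hsum (fun n => ?_)
    rw [norm_mul, Real.norm_eq_abs, Real.norm_eq_abs, abs_of_nonneg (ha0 n)]
    exact mul_le_of_le_one_right (ha0 n) (Real.abs_cos_le_one _)
  have hzero : ∀ k : ℕ, k ≠ 0 → c k ≠ 0 →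
      (∑' n : ℕ, a n * Real.cos (2 * π * n * ((k : ℝ) / q))) = 0 := by
    intro k hk hck
    obtain ⟨ν, k', rfl, h1, h2⟩ := hK k hk hck
    have h3 : k' + p ≤ q := by omega
    have h1R : (p : ℝ) ≤ k' := by exact_mod_cast h1
    have h3R : (k' : ℝ) + p ≤ q := by exact_mod_cast h3
    have hpR : (0 : ℝ) < p := by exact_mod_cast hp
    by_cases hh : 2 * k' ≤ q
    · have hhR : 2 * (k' : ℝ) ≤ q := by exact_mod_cast hh
      have habs : |(k' : ℝ) / q| = k' / q := abs_of_nonneg (by positivity)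
      rw [← hf ((k' : ℝ) / q) (by rw [habs]; gcongr)
        (by rw [habs, div_le_iff₀ hqR]; linarith)]
      refine tsum_congr fun n => ?_
      congr 1
      rw [← Real.cos_add_nat_mul_two_pi (2 * π * n * ((k' : ℝ) / q)) (n * ν)]
      congr 1
      push_cast
      field_simp
      ring
    · have hhR : (q : ℝ) ≤ 2 * k' := by exact_mod_cast (by omega : q ≤ 2 * k')
      have habs : |((q : ℝ) - k') / q| = (q - k') / q :=
        abs_of_nonneg (div_nonneg (by linarith) hqR.le)
      rw [← hf (((q : ℝ) - k') / q) (by rw [habs]; gcongr; linarith)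
        (by rw [habs, div_le_iff₀ hqR]; linarith)]
      refine tsum_congr fun n => ?_
      congr 1
      rw [← Real.cos_neg (2 * π * n * (((q : ℝ) - k') / q)),
        ← Real.cos_add_nat_mul_two_pi (-(2 * π * n * (((q : ℝ) - k') / q))) (n * (ν + 1))]
      congr 1
      push_cast
      field_simp
      ring
  have hre : ∀ n : ℕ, a n * trigEval c (n / q) =
      ∑ k ∈ c.support, c k * (a n * Real.cos (2 * π * n * ((k : ℝ) / q))) := by
    intro n
    rw [trigEval, Finsupp.sum, Finset.mul_sum]
    refine Finset.sum_congr rfl fun k _ => ?_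
    rw [show 2 * π * (k : ℝ) * ((n : ℝ) / q) = 2 * π * n * ((k : ℝ) / q) by ring]
    ring
  have hsummT : Summable (fun n : ℕ => a n * trigEval c (n / q)) := by
    simp_rw [hre]
    exact summable_sum fun k _ => (hS _).mul_left _
  have hmain : c 0 = ∑' n : ℕ, a n * trigEval c (n / q) := by
    simp_rw [hre]
    rw [Summable.tsum_finsetSum fun k _ => (hS _).mul_left _]
    simp_rw [tsum_mul_left]
    rw [Finset.sum_eq_single 0]
    · simp [hsum1]
    · intro k hk hk0
      rw [hzero k hk0 (Finsupp.mem_support_iff.mp hk), mul_zero]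
    · intro h
      rw [Finsupp.notMem_support_iff.mp h, zero_mul]
  refine ⟨hmain, ?_⟩
  rw [hmain]
  have := hsummT.le_tsum 0 (fun n _ => mul_nonneg (ha0 n) (hT _))
  simpa [hT0] using this
end

section
/- Let p, q ∈ ℕ with 2p ≤ q, gcd(p, q) = 1, and let f ∈ K(p/q). Then f(k/q) = 0 for every k ∈ K_{p,q} = {qν + k′ : ν ∈ ℤ_{≥0}, k′ ∈ {p, p+1, …, q−p}}. -/
open Real

/-- If `f ∈ K(p/q)` (with cosine coefficients `a`), then `f(k/q) = 0` for every
`k ∈ K_{p,q}`. -/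
theorem stmt_17 (p q : ℕ) (hp : 0 < p) (hpq : 2 * p ≤ q) (hgcd : Nat.gcd p q = 1)
    (a : ℕ → ℝ) (ha : a ∈ TuranClass (p / q))
    (k : ℕ) (hk : k ∈ Kset p q) :
    (∑' n : ℕ, a n * Real.cos (2 * π * n * (k / q))) = 0 := by
  obtain ⟨-, -, -, hz⟩ := ha
  obtain ⟨ν, k', rfl, h1, h2⟩ := hk
  have hq : 0 < q := by omega
  have hq' : (0:ℝ) < q := by exact_mod_cast hq
  have key : ∀ (x : ℝ) (m : ℕ), (((q * ν + k' : ℕ) : ℝ) / q) = x + m → (p:ℝ) / q ≤ |x| →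
      |x| ≤ 1 / 2 →
      (∑' n : ℕ, a n * Real.cos (2 * π * n * (((q * ν + k' : ℕ) : ℝ) / q))) = 0 := by
    intro x m hx hx1 hx2
    rw [← hz x hx1 hx2]
    refine tsum_congr fun n => ?_
    rw [hx, show 2 * π * n * (x + m) = 2 * π * n * x + (n * m : ℕ) * (2 * π) by push_cast; ring,
      Real.cos_add_nat_mul_two_pi]
  have h3 : (k' : ℝ) + p ≤ q := by
    have : k' + p ≤ q := by omega
    exact_mod_cast this
  have h1' : (p : ℝ) ≤ k' := by exact_mod_cast h1
  have hp' : (0 : ℝ) < p := by exact_mod_cast hp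
  rcases le_total (2 * (k' : ℝ)) q with h | h
  · have habs : |(k' : ℝ) / q| = k' / q := abs_of_nonneg (by positivity)
    refine key (k' / q) ν (by push_cast; field_simp; ring) ?_ ?_
    · rw [habs]; gcongr
    · rw [habs, div_le_div_iff₀ hq' two_pos]; linarith
  · have habs : |((k' : ℝ) - q) / q| = (q - k') / q := by
      rw [abs_div, abs_of_pos hq', abs_of_nonpos (by linarith), neg_sub]
    refine key ((k' - q) / q) (ν + 1) (by push_cast; field_simp; ring) ?_ ?_
    · rw [habs]; gcongr; linarith
    · rw [habs, div_le_div_iff₀ hq' two_pos]; linarith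
end
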